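/- Let q > 4 be a prime power, F = F_q, L = F_{q³}, V = L². Let U be an F-subspace of V of F-dimension 3 that is scattered, i.e., |B(U)| = q² + q + 1 where B(U) = { L·u : u ∈ U, u ≠ 0 }. Then for every nonzero u ∈ U there is exactly one F-subspace U' of V with dim_F U' = 3, u ∈ U', U' ≠ U, and B(U') = B(U). -/

import Mathlib

open Module

section FrobeniusPlanes

variable {F L V : Type*} [Field F] [Field L] [AddCommGroup V] [Module F V] [Module L V]

/-- Two vectors of `X` on a common `L`-line are already `F`-proportional. -/
def IsScatteredSubspace (L : Type*) [Field L] [Module L V] (X : Submodule F V) : Prop :=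
  ∀ p ∈ X, ∀ r ∈ X, p ≠ 0 → ∀ t : L, r = t • p → ∃ a : F, r = a • p

/-- The linear set `B(X)` of `L`-lines spanned by the nonzero vectors of `X`. -/
def linearSetOf (L : Type*) [Field L] [Module L V] (X : Submodule F V) : Set (Submodule L V) :=
  {P | ∃ x ∈ X, x ≠ 0 ∧ P = Submodule.span L {x}}

theorem IsScatteredSubspace.exists_not_mem_line {X : Submodule F V}
    (hS : IsScatteredSubspace L X) (hX : finrank F X = 3) (v : V) :
    ¬ ∀ r ∈ X, ∃ y : L, r = y • v := by
  intro h
  have hne : X ≠ ⊥ := by rintro rfl; simp at hX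
  obtain ⟨p, hp, hp0⟩ := X.exists_mem_ne_zero_of_ne_bot hne
  obtain ⟨y, rfl⟩ := h p hp
  have hy : y ≠ 0 := by rintro rfl; simp at hp0
  have hle : X ≤ Submodule.span F {y • v} := by
    intro r hr
    obtain ⟨z, rfl⟩ := h r hr
    obtain ⟨a, ha⟩ := hS _ hp _ hr hp0 (z / y) (by rw [smul_smul, div_mul_cancel₀ _ hy])
    exact Submodule.mem_span_singleton.2 ⟨a, ha.symm⟩
  have := Submodule.finrank_mono hle
  have := finrank_span_singleton (K := F) hp0
  omega

theorem IsScatteredSubspace.linearIndependent_pair {X : Submodule F V}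
    (hS : IsScatteredSubspace L X) {p r : V} (hp : p ∈ X) (hr : r ∈ X)
    (h : LinearIndependent F ![p, r]) : LinearIndependent L ![p, r] := by
  have hp0 : p ≠ 0 := h.ne_zero 0
  rw [LinearIndependent.pair_iff' hp0] at h ⊢
  intro t ht
  obtain ⟨a, ha⟩ := hS p hp r hr hp0 t ht.symm
  exact h a ha.symm

variable [Algebra F L] [IsScalarTower F L V]

theorem isScatteredSubspace_of_ncard [Fintype F] (X : Submodule F V) (hX : finrank F X = 3)
    (hB : (linearSetOf L X).ncard = Fintype.card F ^ 2 + Fintype.card F + 1) :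
    IsScatteredSubspace L X := by
  have hfin : Module.Finite F X := Module.finite_of_finrank_pos (by omega)
  have : Finite X := Module.finite_of_finite F
  have hcard : Nat.card (Projectivization F X) = Fintype.card F ^ 2 + Fintype.card F + 1 := by
    rw [Projectivization.card_of_finrank F X hX]
    simp [Finset.sum_range_succ]
    ring
  let f : {v : X // v ≠ 0} → linearSetOf L X := fun v =>
    ⟨Submodule.span L {((v : X) : V)}, v, v.1.2, by simpa using v.2, rfl⟩
  let g : Projectivization F X → linearSetOf L X := Projectivization.lift f (by
    rintro ⟨a, ha⟩ ⟨b, hb⟩ t (rfl : a = t • b)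
    have ht : t ≠ 0 := by rintro rfl; exact ha (zero_smul F b)
    apply Subtype.ext
    change Submodule.span L {((t • b : X) : V)} = Submodule.span L {(b : V)}
    rw [Submodule.coe_smul, ← algebraMap_smul L t (b : V)]
    exact Submodule.span_singleton_smul_eq (by simpa using ht) _)
  have hg : Function.Surjective g := by
    rintro ⟨P, x, hx, hx0, rfl⟩
    exact ⟨Projectivization.mk F ⟨x, hx⟩ (by simpa using hx0), rfl⟩
  have : Finite (Projectivization F X) := Nat.finite_of_card_ne_zero (by omega)
  have hgi : Function.Injective g :=
    (hg.bijective_of_nat_card_le (by rw [hcard, ← hB]; rfl)).1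
  intro p hp r hr hp0 t hrt
  by_cases hr0 : r = 0
  · exact ⟨0, by simp [hr0]⟩
  have ht : t ≠ 0 := by rintro rfl; simp at hrt; exact hr0 hrt
  have h := @hgi (Projectivization.mk F ⟨r, hr⟩ (by simpa using hr0))
    (Projectivization.mk F ⟨p, hp⟩ (by simpa using hp0)) (by
      apply Subtype.ext
      change Submodule.span L {r} = Submodule.span L {p}
      rw [hrt]
      exact Submodule.span_singleton_smul_eq (by simpa using ht) _)
  obtain ⟨a, ha⟩ := (Projectivization.mk_eq_mk_iff' F _ _ _ _).1 h
  exact ⟨a, by simpa using (congrArg Subtype.val ha).symm⟩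

theorem IsScatteredSubspace.linearIndependent_relation {X : Submodule F V}
    (hS : IsScatteredSubspace L X) (e : Basis (Fin 3) F X) {w : Fin 3 → L}
    (hw : ∑ i, w i • (e i : V) = 0) (hw0 : w ≠ 0) : LinearIndependent F w := by
  by_contra hdep
  obtain ⟨g, hg, j, hj⟩ := Fintype.not_linearIndependent_iff.1 hdep
  set k := j.succAbove 0
  set l := j.succAbove 1
  rw [Fin.sum_univ_succAbove _ j, Fin.sum_univ_two] at hg hw
  change g j • w j + (g k • w k + g l • w l) = 0 at hg
  change w j • (e j : V) + (w k • (e k : V) + w l • (e l : V)) = 0 at hw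
  have hjk : j ≠ k := (Fin.succAbove_ne _ _).symm
  have hjl : j ≠ l := (Fin.succAbove_ne _ _).symm
  have hkl : k ≠ l := fun h => by simpa using Fin.succAbove_right_injective h
  have hind : LinearIndependent F
      ![((g j • e k - g k • e j : X) : V), ((g j • e l - g l • e j : X) : V)] := by
    rw [LinearIndependent.pair_iff]
    intro s t hst
    have h : s • (g j • e k - g k • e j) + t • (g j • e l - g l • e j) = 0 :=
      Subtype.ext (by simpa using hst)
    have h1 := congrArg (fun x => e.repr x k) h
    have h2 := congrArg (fun x => e.repr x l) h
    simp [hjk, hjl, hkl, hkl.symm, hj] at h1 h2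
    exact ⟨h1, h2⟩
  have hL := LinearIndependent.pair_iff.1
    (hS.linearIndependent_pair (Subtype.mem _) (Subtype.mem _) hind) (w k) (w l) (by
      simp only [Submodule.coe_sub, Submodule.coe_smul, ← algebraMap_smul L (_ : F) (_ : V)]
      simp only [Algebra.smul_def] at hg
      have hg' := congrArg (· • (e j : V)) hg
      simp only [zero_smul] at hg'
      linear_combination (norm := module) (algebraMap F L (g j)) • hw - hg')
  obtain ⟨hk, hl⟩ := hL
  have hwj : w j = 0 := by
    rw [hk, hl] at hg
    simpa [hj] using hg
  apply hw0
  funext i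
  rcases Fin.eq_self_or_eq_succAbove j i with rfl | ⟨m, rfl⟩
  · exact hwj
  · fin_cases m
    · exact hk
    · exact hl

variable (F L) [Fintype F]

/-- The map `x ↦ x b + x^q c`, where `q = |F|`. -/
noncomputable def frobeniusMap (b c : V) : L →ₗ[F] V :=
  (LinearMap.toSpanSingleton L V b).restrictScalars F +
    (LinearMap.toSpanSingleton L V c).restrictScalars F ∘ₗ
      (FiniteField.frobeniusAlgHom F L).toLinearMap

@[simp]
theorem frobeniusMap_apply (b c : V) (x : L) :
    frobeniusMap F L b c x = x • b + x ^ Fintype.card F • c := by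
  simp [frobeniusMap]

variable {F L}

theorem IsScatteredSubspace.exists_eq_range_frobeniusMap [Finite L] (hL : finrank F L = 3)
    (hV : finrank L V = 2) {X : Submodule F V} (hX : finrank F X = 3)
    (hS : IsScatteredSubspace L X) {u : V} (hu : u ∈ X) (hu0 : u ≠ 0) :
    ∃ b c : V, LinearIndependent L ![b, c] ∧ X = LinearMap.range (frobeniusMap F L b c) ∧
      b + c = u := by
  have : Module.Finite F X := Module.finite_of_finrank_pos (by omega)
  have : Module.Finite F L := Module.finite_of_finrank_pos (by omega)
  have : Module.Finite L V := Module.finite_of_finrank_pos (by omega)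
  let e : Basis (Fin 3) F X := finBasisOfFinrankEq F X hX
  obtain ⟨w, hw, i₀, hi₀⟩ : ∃ w : Fin 3 → L, ∑ i, w i • (e i : V) = 0 ∧ ∃ i, w i ≠ 0 := by
    apply Fintype.not_linearIndependent_iff.1
    intro h
    have := h.fintype_card_le_finrank
    simp [hV] at this
  have hwi := hS.linearIndependent_relation e hw (fun h => hi₀ (congrFun h i₀))
  let ψ : L →ₗ[F] V := ∑ i, (Algebra.traceForm F L (w i)).smulRight (e i : V)
  have hψ : ∀ x, ψ x = ∑ i, Algebra.trace F L (w i * x) • (e i : V) := by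
    intro x
    simp [ψ, Algebra.traceForm_apply]
  have hinj : LinearMap.ker ψ = ⊥ := by
    rw [LinearMap.ker_eq_bot']
    intro x hx
    have hz : ∀ i, Algebra.trace F L (w i * x) = 0 := by
      apply Fintype.linearIndependent_iff.1 e.linearIndependent
      apply Subtype.ext
      simpa [hψ] using hx
    have hspan := hwi.span_eq_top_of_card_eq_finrank (by simp [hL])
    refine (traceForm_nondegenerate F L).2 x fun y => ?_
    have hy : y ∈ Submodule.span F (Set.range w) := hspan ▸ Submodule.mem_top
    induction hy using Submodule.span_induction with
    | mem y hy => obtain ⟨i, rfl⟩ := hy; exact hz i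
    | zero => simp
    | add y z _ _ h1 h2 => rw [map_add, LinearMap.add_apply, h1, h2, add_zero]
    | smul a y _ h => rw [map_smul, LinearMap.smul_apply, h, smul_zero]
  have hrange : LinearMap.range ψ = X := by
    apply Submodule.eq_of_le_of_finrank_eq
    · rintro _ ⟨x, rfl⟩
      rw [hψ]
      exact X.sum_mem fun i _ => X.smul_mem _ (e i).2
    · rw [LinearMap.finrank_range_of_inj (LinearMap.ker_eq_bot.1 hinj), hL, hX]
  obtain ⟨b, c, hbc⟩ : ∃ b c : V, X = LinearMap.range (frobeniusMap F L b c) := by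
    refine ⟨∑ i, w i ^ Fintype.card F • (e i : V),
      ∑ i, w i ^ (Fintype.card F ^ 2) • (e i : V), ?_⟩
    have hcomp : ∀ x, ψ x = frobeniusMap F L (∑ i, w i ^ Fintype.card F • (e i : V))
        (∑ i, w i ^ (Fintype.card F ^ 2) • (e i : V)) (x ^ Fintype.card F) := by
      intro x
      rw [hψ]
      have hx : x • ∑ i, w i • (e i : V) = 0 := by rw [hw, smul_zero]
      simp_rw [← algebraMap_smul L (Algebra.trace F L _) (_ : V),
        FiniteField.algebraMap_trace_eq_sum_pow, hL]
      rw [← sub_eq_zero, ← hx, frobeniusMap_apply]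
      simp only [Finset.smul_sum, ← Finset.sum_add_distrib, ← Finset.sum_sub_distrib]
      refine Finset.sum_congr rfl fun i _ => ?_
      simp only [Finset.sum_range_succ, Finset.sum_range_zero, Nat.card_eq_fintype_card,
        smul_smul, ← add_smul, ← sub_smul]
      congr 1
      ring
    refine hrange.symm.trans (le_antisymm ?_ ?_)
    · rintro _ ⟨x, rfl⟩
      exact ⟨_, (hcomp x).symm⟩
    · rintro _ ⟨x, rfl⟩
      obtain ⟨y, hy⟩ := (FiniteField.frobeniusAlgEquivOfAlgebraic F L).surjective x
      refine ⟨y, ?_⟩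
      rw [hcomp, ← hy]
      rfl
  have hmem : ∀ r ∈ X, ∃ y : L, r = y • b + y ^ Fintype.card F • c := by
    intro r hr
    rw [hbc] at hr
    obtain ⟨y, rfl⟩ := hr
    exact ⟨y, by simp⟩
  have hind : LinearIndependent L ![b, c] := by
    rw [LinearIndependent.pair_iff]
    intro s t hst
    by_contra hne
    by_cases ht : t = 0
    · have hs : s ≠ 0 := fun h => hne ⟨h, ht⟩
      have hb : b = 0 := by simpa [ht, hs] using hst
      exact hS.exists_not_mem_line hX c fun r hr => by
        obtain ⟨y, rfl⟩ := hmem r hr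
        exact ⟨y ^ Fintype.card F, by simp [hb]⟩
    · have hc : c = -(s / t) • b := by
        have h : t⁻¹ • (s • b + t • c) = 0 := by rw [hst, smul_zero]
        rw [smul_add, smul_smul, smul_smul, inv_mul_cancel₀ ht, one_smul, add_comm] at h
        rw [eq_neg_of_add_eq_zero_left h, neg_smul, div_eq_inv_mul]
      exact hS.exists_not_mem_line hX b fun r hr => by
        obtain ⟨y, rfl⟩ := hmem r hr
        exact ⟨y + y ^ Fintype.card F * -(s / t), by rw [hc, smul_smul, ← add_smul]⟩
  obtain ⟨x₀, rfl⟩ := hmem u hu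
  have hx₀ : x₀ ≠ 0 := by
    rintro rfl
    simp at hu0
  refine ⟨x₀ • b, x₀ ^ Fintype.card F • c, ?_, ?_, rfl⟩
  · rw [LinearIndependent.pair_iff] at hind ⊢
    intro s t hst
    rw [smul_smul, smul_smul] at hst
    simpa [hx₀] using hind _ _ hst
  · rw [hbc]
    apply le_antisymm
    · rintro _ ⟨x, rfl⟩
      exact ⟨x / x₀, by simp [smul_smul, ← mul_pow, hx₀]⟩
    · rintro _ ⟨x, rfl⟩
      exact ⟨x * x₀, by simp [smul_smul, mul_pow]⟩

theorem linearSetOf_range_frobeniusMap_subset_swap (b c : V) :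
    linearSetOf L (LinearMap.range (frobeniusMap F L b c)) ⊆
      linearSetOf L (LinearMap.range (frobeniusMap F L c b)) := by
  rintro _ ⟨_, ⟨x, rfl⟩, hx, rfl⟩
  have hx0 : x ≠ 0 := by rintro rfl; simp at hx
  have hq : x ^ Fintype.card F ≠ 0 := pow_ne_zero _ hx0
  have key : frobeniusMap F L c b x⁻¹ =
      (x⁻¹ * (x ^ Fintype.card F)⁻¹) • frobeniusMap F L b c x := by
    simp only [frobeniusMap_apply, smul_add, smul_smul, inv_pow]
    rw [mul_right_comm, inv_mul_cancel₀ hx0, one_mul, mul_assoc, inv_mul_cancel₀ hq, mul_one,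
      add_comm]
  have hs : x⁻¹ * (x ^ Fintype.card F)⁻¹ ≠ 0 := by simp [hx0]
  refine ⟨_, ⟨x⁻¹, rfl⟩, ?_, ?_⟩
  · rw [key]; exact smul_ne_zero hs hx
  · rw [key]; exact (Submodule.span_singleton_smul_eq (by simpa using hs) _).symm

theorem linearSetOf_range_frobeniusMap_swap (b c : V) :
    linearSetOf L (LinearMap.range (frobeniusMap F L b c)) =
      linearSetOf L (LinearMap.range (frobeniusMap F L c b)) :=
  (linearSetOf_range_frobeniusMap_subset_swap b c).antisymm
    (linearSetOf_range_frobeniusMap_subset_swap c b)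

theorem frobeniusMap_injective {b c : V} (h : LinearIndependent L ![b, c]) :
    Function.Injective (frobeniusMap F L b c) := by
  rw [← LinearMap.ker_eq_bot, LinearMap.ker_eq_bot']
  intro x hx
  exact (LinearIndependent.pair_iff.1 h _ _ (by simpa using hx)).1

theorem range_frobeniusMap_swap_ne [Finite L] (hL : finrank F L = 3) {b c : V}
    (h : LinearIndependent L ![b, c]) :
    LinearMap.range (frobeniusMap F L c b) ≠ LinearMap.range (frobeniusMap F L b c) := by
  intro heq
  have hfix : ∀ x : L, (x ^ Fintype.card F) ^ Fintype.card F = x := by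
    intro x
    obtain ⟨y, hy⟩ := heq ▸ LinearMap.mem_range_self (frobeniusMap F L c b) x
    simp only [frobeniusMap_apply] at hy
    have := LinearIndependent.pair_iff.1 h (y - x ^ Fintype.card F) (y ^ Fintype.card F - x)
      (by rw [sub_smul, sub_smul]; linear_combination (norm := module) hy)
    rw [← sub_eq_zero.1 this.1]
    exact sub_eq_zero.1 this.2
  have h2 : FiniteField.frobeniusAlgHom F L ^ 2 = 1 := by
    ext x
    rw [pow_two]
    exact hfix x
  have := orderOf_dvd_of_pow_eq_one h2
  rw [FiniteField.orderOf_frobeniusAlgHom, hL] at this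
  omega

open Polynomial in
/-- Comparison of the coefficients of `X ^ (q + 2)` and `X ^ (q ^ 2 + 2)` in the norms of two
`q`-polynomials. -/
theorem coeff_eq_of_norm_eq [Fintype L] {q : ℕ} (hF : Fintype.card F = q) (hq : 2 < q)
    (hL : Fintype.card L = q ^ 3) {α β γ δ : L}
    (h : ∀ x : L, (α * x + γ * x ^ q) * (α * x + γ * x ^ q) ^ q * (α * x + γ * x ^ q) ^ (q ^ 2) =
      (β * x + δ * x ^ q) * (β * x + δ * x ^ q) ^ q * (β * x + δ * x ^ q) ^ (q ^ 2)) :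
    α * α ^ q * γ ^ (q ^ 2) = β * β ^ q * δ ^ (q ^ 2) ∧
      α * γ ^ q * γ ^ (q ^ 2) = β * δ ^ q * δ ^ (q ^ 2) := by
  have hadd : ∀ x y : L, (x + y) ^ q = x ^ q + y ^ q := by
    rw [← hF]
    exact map_add (FiniteField.frobeniusAlgHom F L)
  have hper : ∀ x : L, x ^ (q ^ 3) = x := fun x => by rw [← hL, FiniteField.pow_card]
  let p : L → L → L[X] := fun a c =>
    C (a * a ^ q * a ^ (q ^ 2) + c * c ^ q * c ^ (q ^ 2)) * X ^ (1 + q + q ^ 2) +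
    C (a * a ^ q * c ^ (q ^ 2)) * X ^ (2 + q) +
    C (a * c ^ q * a ^ (q ^ 2)) * X ^ (1 + 2 * q ^ 2) +
    C (a * c ^ q * c ^ (q ^ 2)) * X ^ (2 + q ^ 2) +
    C (c * a ^ q * a ^ (q ^ 2)) * X ^ (2 * q + q ^ 2) +
    C (c * a ^ q * c ^ (q ^ 2)) * X ^ (1 + 2 * q) +
    C (c * c ^ q * a ^ (q ^ 2)) * X ^ (q + 2 * q ^ 2)
  have hp : ∀ a c x, (p a c).eval x =
      (a * x + c * x ^ q) * (a * x + c * x ^ q) ^ q * (a * x + c * x ^ q) ^ (q ^ 2) := by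
    intro a c x
    have h1 : (a * x + c * x ^ q) ^ q = a ^ q * x ^ q + c ^ q * x ^ (q ^ 2) := by
      rw [hadd]; ring
    have h2 : (a * x + c * x ^ q) ^ (q ^ 2) = a ^ (q ^ 2) * x ^ (q ^ 2) + c ^ (q ^ 2) * x := by
      nth_rw 4 [← hper x]
      rw [pow_two, pow_mul, h1, hadd]; ring
    rw [h2, h1]
    simp only [p, eval_add, eval_mul, eval_C, eval_pow, eval_X]
    ring
  have hq2 : 3 * q ≤ q ^ 2 := by nlinarith
  have hq3 : 3 * q ^ 2 ≤ q ^ 3 := by nlinarith [sq_nonneg q]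
  have hdeg : ∀ a c, (p a c).natDegree < q ^ 3 := by
    intro a c
    refine lt_of_le_of_lt (b := q + 2 * q ^ 2) ?_ (by omega)
    simp only [p]
    have hle : ∀ (k : L) (n : ℕ), n ≤ q + 2 * q ^ 2 →
        (C k * X ^ n).natDegree ≤ q + 2 * q ^ 2 :=
      fun k n hn => (natDegree_C_mul_X_pow_le k n).trans hn
    iterate 6 refine natDegree_add_le_of_degree_le ?_ (hle _ _ (by omega))
    exact hle _ _ (by omega)
  have hzero : p α γ = p β δ := by
    rw [← sub_eq_zero]
    refine eq_zero_of_natDegree_lt_card_of_eval_eq_zero' _ Finset.univ (fun x _ => ?_) ?_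
    · rw [eval_sub, hp, hp, h, sub_self]
    · rw [Finset.card_univ, hL]
      exact (natDegree_sub_le _ _).trans_lt (max_lt (hdeg _ _) (hdeg _ _))
  have hc1 : ∀ a c, (p a c).coeff (2 + q) = a * a ^ q * c ^ (q ^ 2) := by
    intro a c
    simp only [p, coeff_add, coeff_C_mul_X_pow]
    rw [if_neg (show 2 + q ≠ 1 + q + q ^ 2 by omega), if_pos trivial,
      if_neg (show 2 + q ≠ 1 + 2 * q ^ 2 by omega), if_neg (show 2 + q ≠ 2 + q ^ 2 by omega),
      if_neg (show 2 + q ≠ 2 * q + q ^ 2 by omega), if_neg (show 2 + q ≠ 1 + 2 * q by omega),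
      if_neg (show 2 + q ≠ q + 2 * q ^ 2 by omega)]
    ring
  have hc2 : ∀ a c, (p a c).coeff (2 + q ^ 2) = a * c ^ q * c ^ (q ^ 2) := by
    intro a c
    simp only [p, coeff_add, coeff_C_mul_X_pow]
    rw [if_neg (show 2 + q ^ 2 ≠ 1 + q + q ^ 2 by omega), if_neg (show 2 + q ^ 2 ≠ 2 + q by omega),
      if_neg (show 2 + q ^ 2 ≠ 1 + 2 * q ^ 2 by omega), if_pos trivial,
      if_neg (show 2 + q ^ 2 ≠ 2 * q + q ^ 2 by omega), if_neg (show 2 + q ^ 2 ≠ 1 + 2 * q by omega),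
      if_neg (show 2 + q ^ 2 ≠ q + 2 * q ^ 2 by omega)]
    ring
  exact ⟨by rw [← hc1, ← hc1, hzero], by rw [← hc2, ← hc2, hzero]⟩

theorem diagonal_or_antidiagonal_of_coeff_eq {α β γ δ : L}
    (hdet : α * δ ≠ β * γ) {q : ℕ} (hq : Fintype.card F = q)
    (h1 : α * α ^ q * γ ^ (q ^ 2) = β * β ^ q * δ ^ (q ^ 2))
    (h2 : α * γ ^ q * γ ^ (q ^ 2) = β * δ ^ q * δ ^ (q ^ 2)) :
    (γ = 0 ∧ β = 0) ∨ (α = 0 ∧ δ = 0) := by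
  subst hq
  have hq0 : Fintype.card F ≠ 0 := Fintype.card_ne_zero
  by_cases hα : α = 0
  · have hβ : β ≠ 0 := by rintro rfl; simp [hα] at hdet
    right
    refine ⟨hα, ?_⟩
    simpa [hα, hβ, hq0] using h1.symm
  by_cases hγ : γ = 0
  · have hδ : δ ≠ 0 := by rintro rfl; simp [hγ] at hdet
    left
    refine ⟨hγ, ?_⟩
    simpa [hγ, hδ, hq0] using h1.symm
  have hne : β * β ^ Fintype.card F * δ ^ (Fintype.card F ^ 2) ≠ 0 := by
    rw [← h1]; simp [hα, hγ]
  have hβ : β ≠ 0 := by rintro rfl; simp at hne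
  have hδ : δ ≠ 0 := by rintro rfl; simp [hq0] at hne
  refine absurd ?_ hdet
  apply (FiniteField.frobeniusAlgHom F L).injective
  change (α * δ) ^ Fintype.card F = (β * γ) ^ Fintype.card F
  have hcancel : α * γ ^ (Fintype.card F ^ 2) * (β * δ ^ (Fintype.card F ^ 2)) ≠ 0 := by
    simp [hα, hβ, hγ, hδ]
  apply mul_left_cancel₀ hcancel
  rw [mul_pow, mul_pow]
  linear_combination (β * δ ^ Fintype.card F * δ ^ (Fintype.card F ^ 2)) * h1 -
    (β * β ^ Fintype.card F * δ ^ (Fintype.card F ^ 2)) * h2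

theorem frobenius_pair_eq_or_swap_of_linearSetOf_subset [Fintype L] {q : ℕ} (hF : Fintype.card F = q)
    (hq : 2 < q) (hL : Fintype.card L = q ^ 3) (hV : finrank L V = 2) {b c b' c' : V}
    (h : LinearIndependent L ![b, c]) (h' : LinearIndependent L ![b', c'])
    (hu : b' + c' = b + c)
    (hB : linearSetOf L (LinearMap.range (frobeniusMap F L b' c')) ⊆
      linearSetOf L (LinearMap.range (frobeniusMap F L b c))) :
    (b' = b ∧ c' = c) ∨ (b' = c ∧ c' = b) := by
  have : Module.Finite L V := Module.finite_of_finrank_pos (by omega)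
  have hspan : ∀ v : V, ∃ s t : L, v = s • b + t • c := by
    intro v
    have htop := h.span_eq_top_of_card_eq_finrank (by simp [hV])
    have hv : v ∈ Submodule.span L (Set.range ![b, c]) := htop ▸ Submodule.mem_top
    rw [Matrix.range_cons, Matrix.range_cons, Matrix.range_empty, Set.union_empty,
      Set.singleton_union, Submodule.mem_span_pair] at hv
    obtain ⟨s, t, hst⟩ := hv
    exact ⟨s, t, hst.symm⟩
  obtain ⟨α, β, rfl⟩ := hspan b'
  obtain ⟨γ, δ, rfl⟩ := hspan c'
  rw [LinearIndependent.pair_iff] at h h'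
  have hcoord : ∀ s t s' t' : L, s • b + t • c = s' • b + t' • c → s = s' ∧ t = t' := by
    intro s t s' t' hst
    have := h (s - s') (t - t')
      (by rw [sub_smul, sub_smul]; linear_combination (norm := module) hst)
    exact ⟨sub_eq_zero.1 this.1, sub_eq_zero.1 this.2⟩
  have hsum := hcoord (α + γ) (β + δ) 1 1 (by
    rw [one_smul, one_smul, ← hu, add_smul, add_smul]; abel)
  have hdet : α * δ ≠ β * γ := by
    intro hd
    have h1 := h' δ (-β) (by
      simp only [smul_add, smul_smul, neg_mul, neg_smul]
      rw [mul_comm δ α, hd, mul_comm δ β]; abel)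
    have h2 := h' γ (-α) (by
      simp only [smul_add, smul_smul, neg_mul, neg_smul]
      rw [hd, mul_comm γ α, mul_comm γ β]; abel)
    have hα : α = 0 := neg_eq_zero.1 h2.2
    have hβ : β = 0 := neg_eq_zero.1 h1.2
    have := (h' 1 0 (by simp [hα, hβ])).1
    exact one_ne_zero this
  have hnorm : ∀ x : L,
      (α * x + γ * x ^ q) * (α * x + γ * x ^ q) ^ q * (α * x + γ * x ^ q) ^ (q ^ 2) =
      (β * x + δ * x ^ q) * (β * x + δ * x ^ q) ^ q * (β * x + δ * x ^ q) ^ (q ^ 2) := by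
    intro x
    by_cases hx : x = 0
    · simp [hx, show q ≠ 0 by omega]
    have hne : frobeniusMap F L (α • b + β • c) (γ • b + δ • c) x ≠ 0 := fun h0 =>
      hx ((h' _ _ (by simpa using h0)).1)
    obtain ⟨_, ⟨y, rfl⟩, -, hy⟩ := hB ⟨_, ⟨x, rfl⟩, hne, rfl⟩
    have hmem := hy ▸ Submodule.mem_span_singleton_self
      (R := L) (frobeniusMap F L (α • b + β • c) (γ • b + δ • c) x)
    obtain ⟨s, hs⟩ := Submodule.mem_span_singleton.1 hmem
    simp only [frobeniusMap_apply, hF] at hs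
    obtain ⟨e1, e2⟩ := hcoord (s * y) (s * y ^ q) (α * x + γ * x ^ q) (β * x + δ * x ^ q) (by
      rw [mul_smul, mul_smul, ← smul_add, hs]
      simp only [smul_add, smul_smul, add_smul, mul_comm x, mul_comm (x ^ q)]
      abel)
    have hper : y ^ (q ^ 3) = y := by rw [← hL, FiniteField.pow_card]
    rw [← e1, ← e2]
    calc _ = s * s ^ q * s ^ (q ^ 2) * y ^ q * y ^ (q ^ 2) * y := by ring
      _ = s * s ^ q * s ^ (q ^ 2) * y ^ q * y ^ (q ^ 2) * y ^ (q ^ 3) := by rw [hper]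
      _ = _ := by ring
  obtain ⟨h1, h2⟩ := coeff_eq_of_norm_eq hF hq hL hnorm
  rcases diagonal_or_antidiagonal_of_coeff_eq hdet hF h1 h2 with ⟨rfl, rfl⟩ | ⟨rfl, rfl⟩
  · left
    have hα : α = 1 := by simpa using hsum.1
    have hδ : δ = 1 := by simpa using hsum.2
    simp [hα, hδ]
  · right
    have hγ : γ = 1 := by simpa using hsum.1
    have hβ : β = 1 := by simpa using hsum.2
    simp [hγ, hβ]

end FrobeniusPlanes

/-- Let `B(U)` be a scattered linear set of rank `3` in `PG(1,q³)`, `q > 4`, and let `u`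
span a point of the underlying subspace `U`.  Then there is exactly one `F_q`-subspace
`U' ≠ U` of dimension `3` containing `u` with `B(U') = B(U)`. -/
theorem scattered_rank3_second_plane (q : ℕ) (hq4 : 4 < q)
    (F : Type) [Field F] [Fintype F] (hq : Fintype.card F = q)
    (L : Type) [Field L] [Fintype L] [Algebra F L] (hL : Fintype.card L = q ^ 3)
    (U : Submodule F (Fin 2 → L)) (hU : finrank F U = 3) :
    let B : Submodule F (Fin 2 → L) → Set (Submodule L (Fin 2 → L)) :=
      fun X => {P | ∃ x ∈ X, x ≠ 0 ∧ P = Submodule.span L {x}}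
    (B U).ncard = q ^ 2 + q + 1 →
    ∀ u : Fin 2 → L, u ∈ U → u ≠ 0 →
      ∃! U' : Submodule F (Fin 2 → L),
        finrank F U' = 3 ∧ u ∈ U' ∧ U' ≠ U ∧ B U' = B U := by
  intro B hcard u hu hu0
  have hdim : finrank F L = 3 := by
    have h := Module.card_eq_pow_finrank (K := F) (V := L)
    rw [hL, hq] at h
    exact (Nat.pow_right_injective (by omega : 2 ≤ q) h).symm
  have hV : finrank L (Fin 2 → L) = 2 := by simp
  have hparam : ∀ X : Submodule F (Fin 2 → L), finrank F X = 3 →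
      (B X).ncard = q ^ 2 + q + 1 → u ∈ X →
      ∃ b c : Fin 2 → L, LinearIndependent L ![b, c] ∧
        X = LinearMap.range (frobeniusMap F L b c) ∧ b + c = u := fun X hX hXB huX =>
    (isScatteredSubspace_of_ncard X hX (by rw [hq]; exact hXB)).exists_eq_range_frobeniusMap
      hdim hV hX huX hu0
  obtain ⟨b, c, hbc, rfl, hbcu⟩ := hparam U hU hcard hu
  have hcb : LinearIndependent L ![c, b] := LinearIndependent.pair_symm_iff.1 hbc
  refine ⟨LinearMap.range (frobeniusMap F L c b),
    ⟨?_, ⟨1, ?_⟩, range_frobeniusMap_swap_ne hdim hbc,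
      linearSetOf_range_frobeniusMap_swap c b⟩, ?_⟩
  · rw [LinearMap.finrank_range_of_inj (frobeniusMap_injective hcb), hdim]
  · simp [← hbcu, add_comm]
  · rintro X ⟨hX, huX, hne, hXB⟩
    obtain ⟨b', c', hbc', rfl, hbcu'⟩ := hparam X hX (hXB ▸ hcard) huX
    rcases frobenius_pair_eq_or_swap_of_linearSetOf_subset hq (by omega) hL hV hbc hbc' (hbcu'.trans hbcu.symm)
      hXB.le with ⟨rfl, rfl⟩ | ⟨rfl, rfl⟩
    · exact absurd rfl hne
    · rfl
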